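/- Let n_1, n_2, n_3 be positive integers with n = n_1 + n_2 + n_3, let ω = e^{2πi/3}, and let Λ = (λ_1,…,λ_n) assign λ_i = ω^{j−1} ∈ ℂ to every index i in the j-th block (the first n_1 indices form block 1, the next n_2 block 2, the last n_3 block 3); in particular λ_1 = 1. Then the page of the open book decomposition of Z^ℂ(Λ) with binding at z_1 = 0, namely Z^ℂ_+(Λ) = Z^ℂ(Λ) ∩ {z ∈ ℂ^n : Im z_1 = 0 and Re z_1 ≥ 0}, is homeomorphic to S^{2n_2 − 1} × S^{2n_3 − 1} × D^{2n_1 − 2}, where D^{2n_1 − 2} is the closed unit ball in ℝ^{2n_1 − 2}. -/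

import Mathlib

open scoped BigOperators

/-- The moment-angle manifold `Z^ℂ(Λ)` of a configuration of complex numbers. -/
def ZC {n : ℕ} (Λ : Fin n → ℂ) : Set (Fin n → ℂ) :=
  {z | (∑ i, Λ i * (Complex.normSq (z i) : ℂ)) = 0 ∧ (∑ i, Complex.normSq (z i)) = 1}
/-- The configuration associated to the cyclic partition `n = n₁ + n₂ + n₃`: with
`ω = e^{2πi/3}`, each index in the `j`-th block is assigned `ω^{j-1}`. -/
noncomputable def triConfig (n₁ n₂ n₃ : ℕ) : Fin (n₁ + n₂ + n₃) → ℂ :=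
  fun i =>
    if (i : ℕ) < n₁ then 1
    else if (i : ℕ) < n₁ + n₂ then Complex.exp (2 * Real.pi * Complex.I / 3)
    else Complex.exp (2 * Real.pi * Complex.I / 3) ^ 2

/-- Real coefficients of `1, ω, ω²` with `ω = e^{2πi/3}` give the sum zero exactly when they
coincide. -/
lemma cubeRoot_combination_eq_zero_iff (a b c : ℝ) :
    (a : ℂ) + Complex.exp (2 * Real.pi * Complex.I / 3) * b
      + Complex.exp (2 * Real.pi * Complex.I / 3) ^ 2 * c = 0 ↔ a = b ∧ b = c := by
  have hω : Complex.exp (2 * Real.pi * Complex.I / 3) = ⟨-1 / 2, √3 / 2⟩ := by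
    have harg : (2 * Real.pi * Complex.I / 3 : ℂ) =
        ((Real.pi - Real.pi / 3 : ℝ) : ℂ) * Complex.I := by
      push_cast; ring
    rw [harg]
    apply Complex.ext
    · rw [Complex.exp_ofReal_mul_I_re, Real.cos_pi_sub, Real.cos_pi_div_three]; norm_num
    · rw [Complex.exp_ofReal_mul_I_im, Real.sin_pi_sub, Real.sin_pi_div_three]
  have h3 : √3 * √3 = 3 := Real.mul_self_sqrt (by norm_num)
  have hpos : 0 < √3 := by positivity
  rw [hω, Complex.ext_iff]
  simp only [Complex.add_re, Complex.add_im, Complex.mul_re, Complex.mul_im, pow_two,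
    Complex.ofReal_re, Complex.ofReal_im, Complex.zero_re, Complex.zero_im]
  constructor
  · rintro ⟨hre, him⟩
    have hbc : √3 * (b - c) = 0 := by linarith
    have : b - c = 0 := (mul_eq_zero.mp hbc).resolve_left hpos.ne'
    exact ⟨by linear_combination hre + c / 4 * h3 - this / 2, sub_eq_zero.mp this⟩
  · rintro ⟨rfl, rfl⟩
    exact ⟨by linear_combination (-a / 4) * h3, by ring⟩

/-- Membership in the moment-angle manifold of the cyclic partition: the three blocks all have
squared norm `1 / 3`. -/
lemma mem_ZC_triConfig_iff {n₁ n₂ n₃ : ℕ} (z : Fin (n₁ + n₂ + n₃) → ℂ) :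
    z ∈ ZC (triConfig n₁ n₂ n₃) ↔
      ∑ i, Complex.normSq (z (Fin.castAdd n₃ (Fin.castAdd n₂ i))) = 1 / 3 ∧
      ∑ i, Complex.normSq (z (Fin.castAdd n₃ (Fin.natAdd n₁ i))) = 1 / 3 ∧
      ∑ i, Complex.normSq (z (Fin.natAdd (n₁ + n₂) i)) = 1 / 3 := by
  simp only [ZC, Set.mem_ofPred_eq, Fin.sum_univ_add]
  have hblock₁ (i : Fin n₁) : triConfig n₁ n₂ n₃ (Fin.castAdd n₃ (Fin.castAdd n₂ i)) = 1 := by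
    simp [triConfig]
  have hblock₂ (i : Fin n₂) : triConfig n₁ n₂ n₃ (Fin.castAdd n₃ (Fin.natAdd n₁ i)) =
      Complex.exp (2 * Real.pi * Complex.I / 3) := by
    simp [triConfig]
  have hblock₃ (i : Fin n₃) : triConfig n₁ n₂ n₃ (Fin.natAdd (n₁ + n₂) i) =
      Complex.exp (2 * Real.pi * Complex.I / 3) ^ 2 := by
    simp [triConfig, add_assoc]
  simp only [hblock₁, hblock₂, hblock₃, one_mul, ← Finset.mul_sum, ← Complex.ofReal_sum,
    cubeRoot_combination_eq_zero_iff]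
  constructor
  · rintro ⟨⟨hab, hbc⟩, hsum⟩
    refine ⟨?_, ?_, ?_⟩ <;> linarith
  · rintro ⟨ha, hb, hc⟩
    refine ⟨⟨?_, ?_⟩, ?_⟩ <;> linarith

/-- `ℂ^m` and `ℝ^d` with `d = 2m` are isometric as real inner product spaces. -/
lemma nonempty_euclidean_complex_isometry {m d : ℕ} (hd : d = 2 * m) :
    Nonempty (EuclideanSpace ℂ (Fin m) ≃ₗᵢ[ℝ] EuclideanSpace ℝ (Fin d)) := by
  have hfinrank : Module.finrank ℝ (EuclideanSpace ℂ (Fin m)) = d := by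
    rw [finrank_real_of_complex, finrank_euclideanSpace_fin, hd]
  exact ⟨(stdOrthonormalBasis ℝ (EuclideanSpace ℂ (Fin m))).equiv
    (EuclideanSpace.basisFun (Fin d) ℝ) (finCongr hfinrank)⟩

/-- A linear isometry restricts to a homeomorphism of unit spheres. -/
noncomputable def LinearIsometryEquiv.sphereHomeomorph {E F : Type*} [NormedAddCommGroup E]
    [NormedSpace ℝ E] [NormedAddCommGroup F] [NormedSpace ℝ F] (e : E ≃ₗᵢ[ℝ] F) :
    Metric.sphere (0 : E) 1 ≃ₜ Metric.sphere (0 : F) 1 :=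
  e.toHomeomorph.subtype fun x => by simp

/-- A linear isometry restricts to a homeomorphism of closed unit balls. -/
noncomputable def LinearIsometryEquiv.closedBallHomeomorph {E F : Type*} [NormedAddCommGroup E]
    [NormedSpace ℝ E] [NormedAddCommGroup F] [NormedSpace ℝ F] (e : E ≃ₗᵢ[ℝ] F) :
    Metric.closedBall (0 : E) 1 ≃ₜ Metric.closedBall (0 : F) 1 :=
  e.toHomeomorph.subtype fun x => by simp

/-- The squared norm of a vector of `ℂ^m` as a sum of `Complex.normSq`. -/
lemma euclidean_normSq_eq_sum {m : ℕ} (x : EuclideanSpace ℂ (Fin m)) :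
    ‖x‖ ^ 2 = ∑ i, Complex.normSq (x i) := by
  simp [EuclideanSpace.norm_sq_eq, Complex.normSq_eq_norm_sq]

/-- Rescaling by `√3` multiplies the sum of squared moduli by `3`. -/
lemma norm_sq_toLp_sqrt_three_mul {m : ℕ} (x : Fin m → ℂ) :
    ‖WithLp.toLp 2 (fun i => (√3 : ℂ) * x i)‖ ^ 2 = 3 * ∑ i, Complex.normSq (x i) := by
  rw [euclidean_normSq_eq_sum]
  simp [Finset.mul_sum]

/-- Rescaling by `(√3)⁻¹` divides the sum of squared moduli by `3`. -/
lemma sum_normSq_inv_sqrt_three_mul {m : ℕ} (x : EuclideanSpace ℂ (Fin m)) :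
    ∑ i, Complex.normSq ((√3 : ℂ)⁻¹ * x i) = ‖x‖ ^ 2 / 3 := by
  rw [euclidean_normSq_eq_sum]
  simp [← Finset.mul_sum]
  ring

/-- The point of the page with given normalized blocks; the first coordinate is determined by
the remaining coordinates of the first block. -/
noncomputable def pagePoint {k n₂ n₃ : ℕ} (u : EuclideanSpace ℂ (Fin n₂))
    (v : EuclideanSpace ℂ (Fin n₃)) (w : EuclideanSpace ℂ (Fin k)) :
    Fin (k + 1 + n₂ + n₃) → ℂ :=
  Fin.append (Fin.append
    (Fin.cons ((√((1 - ‖w‖ ^ 2) / 3) : ℝ) : ℂ) fun i => (√3 : ℂ)⁻¹ * w i)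
    fun i => (√3 : ℂ)⁻¹ * u i) fun i => (√3 : ℂ)⁻¹ * v i

lemma continuous_pagePoint {k n₂ n₃ : ℕ} :
    Continuous fun p : EuclideanSpace ℂ (Fin n₂) × EuclideanSpace ℂ (Fin n₃) ×
      EuclideanSpace ℂ (Fin k) => pagePoint p.1 p.2.1 p.2.2 := by
  refine continuous_pi fun i => ?_
  refine Fin.addCases (fun i => Fin.addCases (fun i => Fin.cases ?_ (fun i => ?_) i)
    (fun i => ?_) i) (fun i => ?_) i
  all_goals
    simp only [pagePoint, Fin.append_left, Fin.append_right, Fin.cons_zero, Fin.cons_succ]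
    fun_prop

/-- The page of the open book with binding at `z₁ = 0`, in complex coordinates. -/
noncomputable def pageHomeomorph (k n₂ n₃ : ℕ) :
    {z ∈ ZC (triConfig (k + 1) n₂ n₃) |
        (z (Fin.castAdd n₃ (Fin.castAdd n₂ 0))).im = 0 ∧
        0 ≤ (z (Fin.castAdd n₃ (Fin.castAdd n₂ 0))).re} ≃ₜ
      (Metric.sphere (0 : EuclideanSpace ℂ (Fin n₂)) 1 ×
        Metric.sphere (0 : EuclideanSpace ℂ (Fin n₃)) 1 ×
        Metric.closedBall (0 : EuclideanSpace ℂ (Fin k)) 1) where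
  toFun z :=
    (⟨WithLp.toLp 2 fun i => (√3 : ℂ) * z.1 (Fin.castAdd n₃ (Fin.natAdd (k + 1) i)), by
        have h := ((mem_ZC_triConfig_iff z.1).mp z.2.1).2.1
        rw [mem_sphere_zero_iff_norm, ← sq_eq_sq₀ (norm_nonneg _) zero_le_one,
          norm_sq_toLp_sqrt_three_mul, h]
        norm_num⟩,
      ⟨WithLp.toLp 2 fun i => (√3 : ℂ) * z.1 (Fin.natAdd (k + 1 + n₂) i), by
        have h := ((mem_ZC_triConfig_iff z.1).mp z.2.1).2.2
        rw [mem_sphere_zero_iff_norm, ← sq_eq_sq₀ (norm_nonneg _) zero_le_one,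
          norm_sq_toLp_sqrt_three_mul, h]
        norm_num⟩,
      ⟨WithLp.toLp 2 fun i => (√3 : ℂ) * z.1 (Fin.castAdd n₃ (Fin.castAdd n₂ i.succ)), by
        have h := ((mem_ZC_triConfig_iff z.1).mp z.2.1).1
        rw [Fin.sum_univ_succ] at h
        rw [mem_closedBall_zero_iff, ← sq_le_sq₀ (norm_nonneg _) zero_le_one,
          norm_sq_toLp_sqrt_three_mul]
        linarith [Complex.normSq_nonneg (z.1 (Fin.castAdd n₃ (Fin.castAdd n₂ 0)))]⟩)
  invFun p := ⟨pagePoint p.1.1 p.2.1.1 p.2.2.1, by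
    obtain ⟨⟨u, hu⟩, ⟨v, hv⟩, ⟨w, hw⟩⟩ := p
    rw [mem_sphere_zero_iff_norm] at hu hv
    rw [mem_closedBall_zero_iff] at hw
    have hw' : 0 ≤ (1 - ‖w‖ ^ 2) / 3 := by nlinarith [norm_nonneg w]
    refine ⟨(mem_ZC_triConfig_iff _).mpr ⟨?_, ?_, ?_⟩, ?_, ?_⟩
    · simp only [pagePoint, Fin.append_left, Fin.sum_univ_succ, Fin.cons_zero, Fin.cons_succ,
        sum_normSq_inv_sqrt_three_mul, Complex.normSq_ofReal, Real.mul_self_sqrt hw']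
      ring
    · simp only [pagePoint, Fin.append_left, Fin.append_right, sum_normSq_inv_sqrt_three_mul, hu]
      norm_num
    · simp only [pagePoint, Fin.append_right, sum_normSq_inv_sqrt_three_mul, hv]
      norm_num
    · simp [pagePoint, Fin.append_left]
    · simp only [pagePoint, Fin.append_left, Fin.cons_zero, Complex.ofReal_re]
      positivity⟩
  left_inv z := by
    obtain ⟨z, hz, him, hre⟩ := z
    have h := ((mem_ZC_triConfig_iff z).mp hz).1
    rw [Fin.sum_univ_succ] at h
    have h3 : (√3 : ℂ) ≠ 0 := by simp
    apply Subtype.ext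
    funext i
    induction i using Fin.addCases with
    | left i =>
      induction i using Fin.addCases with
      | left i =>
        cases i using Fin.cases with
        | zero =>
          simp only [pagePoint, Fin.append_left, Fin.cons_zero, norm_sq_toLp_sqrt_three_mul]
          rw [Complex.normSq_apply, him] at h
          apply Complex.ext
          · rw [Complex.ofReal_re, ← Real.sqrt_mul_self hre]
            congr 1
            linarith
          · rw [Complex.ofReal_im, him]
        | succ i => simp [pagePoint, Fin.append_left, h3]
      | right i => simp [pagePoint, Fin.append_left, Fin.append_right, h3]
    | right i => simp [pagePoint, Fin.append_right, h3]
  right_inv p := by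
    have h3 : (√3 : ℂ) ≠ 0 := by simp
    refine Prod.ext (Subtype.ext ?_) (Prod.ext (Subtype.ext ?_) (Subtype.ext ?_)) <;>
      ext i <;> simp [pagePoint, Fin.append_left, Fin.append_right, h3]
  continuous_toFun := by
    refine .prodMk (.subtype_mk ?_ _) (.prodMk (.subtype_mk ?_ _) (.subtype_mk ?_ _)) <;>
      exact (PiLp.continuous_toLp 2 _).comp (continuous_pi fun _ =>
        continuous_const.mul ((continuous_apply _).comp continuous_subtype_val))
  continuous_invFun := by
    refine Continuous.subtype_mk (continuous_pagePoint.comp (by fun_prop :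
      Continuous fun p : (Metric.sphere (0 : EuclideanSpace ℂ (Fin n₂)) 1 ×
        Metric.sphere (0 : EuclideanSpace ℂ (Fin n₃)) 1 ×
        Metric.closedBall (0 : EuclideanSpace ℂ (Fin k)) 1) =>
          (p.1.1, p.2.1.1, p.2.2.1))) _

/-- Part (a) of the description of the pages of the open book decompositions of
moment-angle manifolds: for the cyclic partition `n = n₁ + n₂ + n₃` (with `λ₁ = 1`), the
page `Z^ℂ₊(Λ) = Z^ℂ(Λ) ∩ {Im z₁ = 0, Re z₁ ≥ 0}` of the open book decomposition with
binding at `z₁ = 0` is homeomorphic to `S^{2n₂−1} × S^{2n₃−1} × D^{2n₁−2}`. -/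
theorem ZCPlus_triple_product {n₁ n₂ n₃ : ℕ}
    (h₁ : 0 < n₁) (h₂ : 0 < n₂) (h₃ : 0 < n₃) :
    Nonempty (↥{z ∈ ZC (triConfig n₁ n₂ n₃) |
        (z ⟨0, by omega⟩).im = 0 ∧ 0 ≤ (z ⟨0, by omega⟩).re} ≃ₜ
      (Metric.sphere (0 : EuclideanSpace ℝ (Fin (2 * n₂))) 1 ×
        Metric.sphere (0 : EuclideanSpace ℝ (Fin (2 * n₃))) 1 ×
        Metric.closedBall (0 : EuclideanSpace ℝ (Fin (2 * n₁ - 2))) 1)) := by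
  obtain ⟨k, rfl⟩ : ∃ k, n₁ = k + 1 := ⟨n₁ - 1, by omega⟩
  obtain ⟨e₂⟩ := nonempty_euclidean_complex_isometry (m := n₂) rfl
  obtain ⟨e₃⟩ := nonempty_euclidean_complex_isometry (m := n₃) rfl
  obtain ⟨e₁⟩ := nonempty_euclidean_complex_isometry (m := k) (d := 2 * (k + 1) - 2) (by omega)
  exact ⟨(pageHomeomorph k n₂ n₃).trans (e₂.sphereHomeomorph.prodCongr
    (e₃.sphereHomeomorph.prodCongr e₁.closedBallHomeomorph))⟩
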